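/- Let λ be a composition of r and y_λ = Σ_{w ∈ S_λ} (-q^{-1})^{ℓ(w)} T_w in H^c_{r,R} with q invertible. Then y_λ H^c_{r,R} = {h ∈ H^c_{r,R} : T_{s_k} h = -h for all simple transpositions s_k ∈ S_λ}. -/

import Mathlib

namespace HCPaper

noncomputable section

open MulOpposite

/-- Generators of the Hecke-Clifford superalgebra: `Sum.inl i` is `T_{i+1}` (0-based `i < r-1`),
`Sum.inr j` is `c_{j+1}` (0-based `j < r`). -/
abbrev Gen (r : ℕ) := (Fin (r - 1)) ⊕ (Fin r)

/-- The index `i` viewed in `Fin r` (the first of the two indices moved by `T_i`). -/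
def loIdx {r : ℕ} (i : Fin (r - 1)) : Fin r := ⟨i.val, by have := i.isLt; omega⟩

/-- The index `i+1` viewed in `Fin r`. -/
def hiIdx {r : ℕ} (i : Fin (r - 1)) : Fin r := ⟨i.val + 1, by have := i.isLt; omega⟩

def Tf (R : Type) [CommRing R] (r : ℕ) (i : Fin (r - 1)) : FreeAlgebra R (Gen r) :=
  FreeAlgebra.ι R (Sum.inl i)

def Cf (R : Type) [CommRing R] (r : ℕ) (j : Fin r) : FreeAlgebra R (Gen r) :=
  FreeAlgebra.ι R (Sum.inr j)

/-- The defining relations of the Hecke-Clifford superalgebra `H^c_{r,R}`. -/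
inductive HCRel (R : Type) [CommRing R] (q : R) (r : ℕ) :
    FreeAlgebra R (Gen r) → FreeAlgebra R (Gen r) → Prop
  | csq (j : Fin r) : HCRel R q r (Cf R r j * Cf R r j) (-1)
  | canti (i j : Fin r) (h : i ≠ j) :
      HCRel R q r (Cf R r i * Cf R r j) (-(Cf R r j * Cf R r i))
  | quad (i : Fin (r - 1)) :
      HCRel R q r ((Tf R r i - algebraMap R _ q) * (Tf R r i + 1)) 0
  | commTT (i i' : Fin (r - 1)) (h : i.val + 1 < i'.val) :
      HCRel R q r (Tf R r i * Tf R r i') (Tf R r i' * Tf R r i)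
  | braid (i i' : Fin (r - 1)) (h : i'.val = i.val + 1) :
      HCRel R q r (Tf R r i * Tf R r i' * Tf R r i) (Tf R r i' * Tf R r i * Tf R r i')
  | commTC (i : Fin (r - 1)) (j : Fin r) (h1 : j.val ≠ i.val) (h2 : j.val ≠ i.val + 1) :
      HCRel R q r (Tf R r i * Cf R r j) (Cf R r j * Tf R r i)
  | TClo (i : Fin (r - 1)) :
      HCRel R q r (Tf R r i * Cf R r (loIdx i)) (Cf R r (hiIdx i) * Tf R r i)
  | TChi (i : Fin (r - 1)) :
      HCRel R q r (Tf R r i * Cf R r (hiIdx i))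
        (Cf R r (loIdx i) * Tf R r i -
          algebraMap R _ (q - 1) * (Cf R r (loIdx i) - Cf R r (hiIdx i)))

/-- The Hecke-Clifford superalgebra `H^c_{r,R}` with parameter `q`, as a quotient of
the free algebra by the defining relations. -/
abbrev HC (R : Type) [CommRing R] (q : R) (r : ℕ) := RingQuot (HCRel R q r)

/-- The generator `T_{i+1}` of `H^c_{r,R}` (0-based index). -/
def TT (R : Type) [CommRing R] (q : R) (r : ℕ) (i : Fin (r - 1)) : HC R q r :=
  RingQuot.mkAlgHom R (HCRel R q r) (Tf R r i)

/-- The generator `c_{j+1}` of `H^c_{r,R}` (0-based index). -/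
def CC (R : Type) [CommRing R] (q : R) (r : ℕ) (j : Fin r) : HC R q r :=
  RingQuot.mkAlgHom R (HCRel R q r) (Cf R r j)

end

end HCPaper
namespace HCPaper

/-- The Coxeter length of a permutation of `Fin r`: its number of inversions. -/
def len {r : ℕ} (w : Equiv.Perm (Fin r)) : ℕ :=
  (Finset.univ.filter fun p : Fin r × Fin r => p.1 < p.2 ∧ w p.2 < w p.1).card

/-- The simple transposition `s_{k+1} = (k+1, k+2)` (0-based `k < r-1`) as a permutation. -/
def simpleT {r : ℕ} (k : Fin (r - 1)) : Equiv.Perm (Fin r) :=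
  Equiv.swap (loIdx k) (hiIdx k)

/-- Partial sum `λ_1 + ⋯ + λ_k` of a composition. -/
def psum {n : ℕ} (lam : Fin n → ℕ) (k : ℕ) : ℕ :=
  ∑ i : Fin n, if (i : ℕ) < k then lam i else 0

/-- `j` (0-based) lies in the `k`-th block `R^λ_{k+1}` of the composition `λ`. -/
def InBlock {n r : ℕ} (lam : Fin n → ℕ) (k : Fin n) (j : Fin r) : Prop :=
  psum lam (k : ℕ) ≤ (j : ℕ) ∧ (j : ℕ) < psum lam (k : ℕ) + lam k

instance {n r : ℕ} (lam : Fin n → ℕ) (k : Fin n) (j : Fin r) : Decidable (InBlock lam k j) := by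
  unfold InBlock; infer_instance

/-- Membership in the Young subgroup `S_λ`: `w` preserves each block of `λ`. -/
def MemYoung {n r : ℕ} (lam : Fin n → ℕ) (w : Equiv.Perm (Fin r)) : Prop :=
  ∀ (k : Fin n) (j : Fin r), InBlock lam k j → InBlock lam k (w j)

instance {n r : ℕ} (lam : Fin n → ℕ) (w : Equiv.Perm (Fin r)) : Decidable (MemYoung lam w) := by
  unfold MemYoung; infer_instance

/-- `d` is the minimal length element of the double coset `S_λ d S_μ`. -/
def MinDouble {r n1 n2 : ℕ} (lam : Fin n1 → ℕ) (mu : Fin n2 → ℕ) (d : Equiv.Perm (Fin r)) :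
    Prop :=
  ∀ u σ : Equiv.Perm (Fin r), MemYoung lam u → MemYoung mu σ → len d ≤ len (u * d * σ)

end HCPaper
namespace HCPaper

noncomputable section

/-- `TW` is the standard basis `w ↦ T_w` of the Hecke subalgebra of `H^c_{r,R}`:
`T_1 = 1` and `T_{w s_k} = T_w T_{s_k}` whenever `ℓ(w s_k) = ℓ(w) + 1`. -/
def IsTW {R : Type} [CommRing R] (q : R) (r : ℕ) (TW : Equiv.Perm (Fin r) → HC R q r) :
    Prop :=
  TW 1 = 1 ∧ ∀ (w : Equiv.Perm (Fin r)) (k : Fin (r - 1)),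
    len (w * simpleT k) = len w + 1 → TW (w * simpleT k) = TW w * TT R q r k

/-- The element `x_λ = ∑_{w ∈ S_λ} T_w` of `H^c_{r,R}`. -/
def xElt {R : Type} [CommRing R] {q : R} {r n : ℕ} (lam : Fin n → ℕ)
    (TW : Equiv.Perm (Fin r) → HC R q r) : HC R q r :=
  ∑ w : Equiv.Perm (Fin r), if MemYoung lam w then TW w else 0

/-- The element `c_{q,r} = q^{r-1} c_1 + q^{r-2} c_2 + ⋯ + c_r` of `H^c_{r,R}`. -/
def cqr (R : Type) [CommRing R] (q : R) (r : ℕ) : HC R q r :=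
  ∑ j : Fin r, q ^ (r - 1 - (j : ℕ)) • CC R q r j

/-- The element `c'_{q,r} = c_1 + q c_2 + ⋯ + q^{r-1} c_r` of `H^c_{r,R}`. -/
def cqr' (R : Type) [CommRing R] (q : R) (r : ℕ) : HC R q r :=
  ∑ j : Fin r, q ^ (j : ℕ) • CC R q r j

end

end HCPaper

namespace HCPaper

noncomputable section

/-- The element `y_λ = ∑_{w ∈ S_λ} (-q⁻¹)^{ℓ(w)} T_w` of `H^c_{r,R}`. -/
def yElt {R : Type} [CommRing R] {q : R} {r n : ℕ} (lam : Fin n → ℕ)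
    (TW : Equiv.Perm (Fin r) → HC R q r) : HC R q r :=
  ∑ w : Equiv.Perm (Fin r),
    if MemYoung lam w then (-(Ring.inverse q)) ^ (len w) • TW w else 0

end

end HCPaper

namespace HCPaper

section Comb

variable {r : ℕ}

lemma lo_lt_hi (k : Fin (r - 1)) : loIdx k < hiIdx k := by
  simp [loIdx, hiIdx, Fin.lt_def]

lemma lo_ne_hi (k : Fin (r - 1)) : loIdx k ≠ hiIdx k := (lo_lt_hi k).ne

lemma simpleT_mul_self (k : Fin (r - 1)) : simpleT k * simpleT k = 1 := by
  simp [simpleT]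

lemma simpleT_inv (k : Fin (r - 1)) : (simpleT k)⁻¹ = simpleT k := by
  simp [simpleT]

lemma simpleT_lo (k : Fin (r - 1)) : simpleT k (loIdx k) = hiIdx k := by simp [simpleT]
lemma simpleT_hi (k : Fin (r - 1)) : simpleT k (hiIdx k) = loIdx k := by simp [simpleT]

lemma simpleT_ne_one (k : Fin (r - 1)) : simpleT k ≠ 1 := by
  intro h
  have := simpleT_lo k
  rw [h] at this
  exact lo_ne_hi k (by simpa using this)

lemma simpleT_simpleT (k : Fin (r - 1)) (a : Fin r) : simpleT k (simpleT k a) = a := by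
  simp [simpleT]

/-- `s_k` preserves the order of a pair, unless the pair is `(k, k+1)`. -/
lemma simpleT_lt (k : Fin (r - 1)) {a b : Fin r} (hab : a < b)
    (h : ¬ (a = loIdx k ∧ b = hiIdx k)) : simpleT k a < simpleT k b := by
  simp only [simpleT, Equiv.swap_apply_def]
  simp only [Fin.ext_iff, Fin.lt_def, loIdx, hiIdx] at *
  split_ifs <;> first | omega | (dsimp only; omega)

lemma len_mul_up (w : Equiv.Perm (Fin r)) (k : Fin (r - 1)) (h : w (loIdx k) < w (hiIdx k)) :
    len (w * simpleT k) = len w + 1 := by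
  classical
  unfold len
  have key : (Finset.univ.filter fun p : Fin r × Fin r =>
      p.1 < p.2 ∧ (w * simpleT k) p.2 < (w * simpleT k) p.1)
      = insert (loIdx k, hiIdx k)
        ((Finset.univ.filter fun p : Fin r × Fin r => p.1 < p.2 ∧ w p.2 < w p.1).map
          ((simpleT k).prodCongr (simpleT k)).toEmbedding) := by
    ext ⟨a, b⟩
    rw [Finset.mem_filter]
    simp only [Finset.mem_filter, Finset.mem_univ, true_and, Equiv.Perm.coe_mul,
      Function.comp_apply, Finset.mem_insert, Finset.mem_map, Prod.mk.injEq, Prod.exists,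
      Equiv.coe_toEmbedding, Equiv.prodCongr_apply, Prod.map_apply]
    constructor
    · rintro ⟨h1, h2⟩
      by_cases hc : a = loIdx k ∧ b = hiIdx k
      · exact Or.inl hc
      · exact Or.inr ⟨_, _, ⟨simpleT_lt k h1 hc, h2⟩, simpleT_simpleT k a, simpleT_simpleT k b⟩
    · rintro (⟨rfl, rfl⟩ | ⟨c, d, ⟨h1, h2⟩, rfl, rfl⟩)
      · rw [simpleT_lo, simpleT_hi]; exact ⟨lo_lt_hi k, h⟩
      · rw [simpleT_simpleT, simpleT_simpleT]
        refine ⟨simpleT_lt k h1 ?_, h2⟩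
        rintro ⟨rfl, rfl⟩
        exact absurd h h2.asymm
  rw [key, Finset.card_insert_of_notMem, Finset.card_map]
  simp only [Finset.mem_map, Finset.mem_filter, Finset.mem_univ, true_and, Prod.exists,
      Equiv.coe_toEmbedding, Equiv.prodCongr_apply, Prod.map_apply, Prod.mk.injEq, not_exists,
      not_and]
  rintro c d ⟨h1, -⟩ h3 h4
  have hc : c = hiIdx k := by rw [← simpleT_simpleT k c, h3, simpleT_lo]
  have hd : d = loIdx k := by rw [← simpleT_simpleT k d, h4, simpleT_hi]
  subst hc hd
  exact absurd h1 (lo_lt_hi k).asymm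

lemma len_mul_down (w : Equiv.Perm (Fin r)) (k : Fin (r - 1)) (h : w (hiIdx k) < w (loIdx k)) :
    len w = len (w * simpleT k) + 1 := by
  have := len_mul_up (w * simpleT k) k (by simpa [simpleT_lo, simpleT_hi] using h)
  rwa [mul_assoc, simpleT_mul_self, mul_one] at this

lemma len_mul_iff (w : Equiv.Perm (Fin r)) (k : Fin (r - 1)) :
    len (w * simpleT k) = len w + 1 ↔ w (loIdx k) < w (hiIdx k) := by
  refine ⟨fun h => ?_, len_mul_up w k⟩
  by_contra hc
  have := len_mul_down w k (lt_of_le_of_ne (not_lt.1 hc) fun e => lo_ne_hi k (w.injective e.symm))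
  omega

lemma len_inv (w : Equiv.Perm (Fin r)) : len w⁻¹ = len w := by
  unfold len
  refine Finset.card_bij' (fun p _ => (w⁻¹ p.2, w⁻¹ p.1)) (fun p _ => (w p.2, w p.1)) ?_ ?_ ?_ ?_
  all_goals simp +contextual

lemma len_mul_left_up (w : Equiv.Perm (Fin r)) (k : Fin (r - 1))
    (h : w⁻¹ (loIdx k) < w⁻¹ (hiIdx k)) : len (simpleT k * w) = len w + 1 := by
  rw [← len_inv, ← len_inv w, mul_inv_rev, simpleT_inv]
  exact len_mul_up _ k h

lemma len_mul_left_iff (w : Equiv.Perm (Fin r)) (k : Fin (r - 1)) :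
    len (simpleT k * w) = len w + 1 ↔ w⁻¹ (loIdx k) < w⁻¹ (hiIdx k) := by
  rw [← len_inv, ← len_inv w, mul_inv_rev, simpleT_inv]
  exact len_mul_iff _ k

lemma len_mul_left_down (w : Equiv.Perm (Fin r)) (k : Fin (r - 1))
    (h : w⁻¹ (hiIdx k) < w⁻¹ (loIdx k)) : len w = len (simpleT k * w) + 1 := by
  rw [← len_inv, ← len_inv (simpleT k * w), mul_inv_rev, simpleT_inv]
  exact len_mul_down _ k h

lemma len_one : len (1 : Equiv.Perm (Fin r)) = 0 := by
  rw [len, Finset.card_eq_zero, Finset.filter_eq_empty_iff]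
  rintro ⟨a, b⟩ - ⟨h1, h2⟩
  exact absurd h1 h2.asymm

/-- A non-trivial permutation has a right descent. -/
lemma exists_descent (w : Equiv.Perm (Fin r)) (hw : w ≠ 1) :
    ∃ k : Fin (r - 1), w (hiIdx k) < w (loIdx k) := by
  by_contra hc
  push Not at hc
  apply hw
  cases r with
  | zero => ext x; exact x.elim0
  | succ m =>
    have hm : StrictMono w := by
      rw [Fin.strictMono_iff_lt_succ]
      intro i
      have h1 := hc ⟨i, by simp⟩
      refine lt_of_le_of_ne h1 fun e => ?_
      have := w.injective e
      simp [Fin.ext_iff] at this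
    have := Subsingleton.elim (hm.orderIsoOfSurjective _ w.surjective) (OrderIso.refl _)
    ext x
    have := congrArg (fun e : Fin (m+1) ≃o Fin (m+1) => e x) this
    simpa using congrArg Fin.val this

end Comb

end HCPaper
namespace HCPaper

noncomputable section

/-- Defining relations of the Clifford algebra. -/
inductive ClRel (R : Type) [CommRing R] (r : ℕ) :
    FreeAlgebra R (Fin r) → FreeAlgebra R (Fin r) → Prop
  | csq (j : Fin r) : ClRel R r (FreeAlgebra.ι R j * FreeAlgebra.ι R j) (-1)
  | canti (i j : Fin r) (h : i ≠ j) :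
      ClRel R r (FreeAlgebra.ι R i * FreeAlgebra.ι R j) (-(FreeAlgebra.ι R j * FreeAlgebra.ι R i))

/-- The Clifford algebra. -/
def Cl (R : Type) [CommRing R] (r : ℕ) : Type := RingQuot (ClRel R r)

instance (R : Type) [CommRing R] (r : ℕ) : Ring (Cl R r) :=
  inferInstanceAs (Ring (RingQuot (ClRel R r)))

instance (R : Type) [CommRing R] (r : ℕ) : Algebra R (Cl R r) :=
  inferInstanceAs (Algebra R (RingQuot (ClRel R r)))

/-- The quotient map. -/
def clMk (R : Type) [CommRing R] (r : ℕ) : FreeAlgebra R (Fin r) →ₐ[R] Cl R r :=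
  RingQuot.mkAlgHom R (ClRel R r)

/-- A copy of the Hecke-Clifford algebra, with controlled instances. -/
def HA (R : Type) [CommRing R] (q : R) (r : ℕ) : Type := HC R q r

instance (R : Type) [CommRing R] (q : R) (r : ℕ) : Ring (HA R q r) :=
  inferInstanceAs (Ring (HC R q r))

instance (R : Type) [CommRing R] (q : R) (r : ℕ) : Algebra R (HA R q r) :=
  inferInstanceAs (Algebra R (HC R q r))

/-- The quotient map. -/
def hcMk (R : Type) [CommRing R] (q : R) (r : ℕ) : FreeAlgebra R (Gen r) →ₐ[R] HA R q r :=
  RingQuot.mkAlgHom R (HCRel R q r)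

/-- The generator `T`. -/
def tA (R : Type) [CommRing R] (q : R) (r : ℕ) (i : Fin (r - 1)) : HA R q r := TT R q r i

/-- The generator `c`. -/
def cA (R : Type) [CommRing R] (q : R) (r : ℕ) (j : Fin r) : HA R q r := CC R q r j

/-- Clifford generators. -/
def cg (R : Type) [CommRing R] (r : ℕ) (j : Fin r) : Cl R r :=
  clMk R r (FreeAlgebra.ι R j)

section

variable {R : Type} [CommRing R] {r : ℕ}

lemma clMk_surj (x : Cl R r) : ∃ y, clMk R r y = x :=
  RingQuot.mkAlgHom_surjective R (ClRel R r) x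

lemma hcMk_surj {q : R} (x : HA R q r) : ∃ y, hcMk R q r y = x :=
  RingQuot.mkAlgHom_surjective R (HCRel R q r) x

lemma clMk_rel {x y : FreeAlgebra R (Fin r)} (h : ClRel R r x y) : clMk R r x = clMk R r y :=
  RingQuot.mkAlgHom_rel R h

lemma hcMk_rel {q : R} {x y : FreeAlgebra R (Gen r)} (h : HCRel R q r x y) :
    hcMk R q r x = hcMk R q r y :=
  RingQuot.mkAlgHom_rel R h

lemma hcMk_T {q : R} (i : Fin (r - 1)) : hcMk R q r (Tf R r i) = tA R q r i := rfl

lemma hcMk_C {q : R} (i : Fin r) : hcMk R q r (Cf R r i) = cA R q r i := rfl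

lemma cg_sq (j : Fin r) : cg R r j * cg R r j = -1 := by
  have := clMk_rel (ClRel.csq (R := R) j)
  simpa [cg] using this

lemma cg_anti (i j : Fin r) (h : i ≠ j) : cg R r i * cg R r j = -(cg R r j * cg R r i) := by
  have := clMk_rel (ClRel.canti (R := R) i j h)
  simpa [cg] using this

/-- Lift out of the Clifford algebra. -/
def clLift {B : Type} [Ring B] [Algebra R B] (g : Fin r → B) (h1 : ∀ j, g j * g j = -1)
    (h2 : ∀ i j, i ≠ j → g i * g j = -(g j * g i)) : Cl R r →ₐ[R] B :=
  (RingQuot.liftAlgHom R ⟨FreeAlgebra.lift R g, by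
    intro x y h
    cases h with
    | csq j => simp [h1]
    | canti i j h => simpa using h2 i j h⟩ : RingQuot (ClRel R r) →ₐ[R] B)

lemma clLift_cg {B : Type} [Ring B] [Algebra R B] (g : Fin r → B) (h1 : ∀ j, g j * g j = -1)
    (h2 : ∀ i j, i ≠ j → g i * g j = -(g j * g i)) (j : Fin r) :
    clLift (R := R) g h1 h2 (cg R r j) = g j := by
  have := RingQuot.liftAlgHom_mkAlgHom_apply R (FreeAlgebra.lift R g) (s := ClRel R r) (by
    intro x y h
    cases h with
    | csq j => simp [h1]
    | canti i j h => simpa using h2 i j h) (FreeAlgebra.ι R j)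
  rw [FreeAlgebra.lift_ι_apply] at this
  exact this

/-- Induction by right multiplication by generators. -/
lemma cl_induction {P : Cl R r → Prop} (x : Cl R r) (hone : P 1)
    (hadd : ∀ x y, P x → P y → P (x + y)) (hsmul : ∀ (a : R) x, P x → P (a • x))
    (hmul : ∀ x j, P x → P (x * cg R r j)) : P x := by
  have main : ∀ y : FreeAlgebra R (Fin r), ∀ z, P z → P (z * clMk R r y) := by
    intro y
    induction y using FreeAlgebra.induction with
    | grade0 a =>
      intro z hz
      rw [AlgHom.commutes, ← Algebra.commutes, ← Algebra.smul_def]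
      exact hsmul _ _ hz
    | grade1 j => intro z hz; exact hmul _ _ hz
    | mul a b ha hb =>
      intro z hz
      rw [map_mul, ← mul_assoc]
      exact hb _ (ha _ hz)
    | add a b ha hb =>
      intro z hz
      rw [map_add, mul_add]
      exact hadd _ _ (ha _ hz) (hb _ hz)
  obtain ⟨y, rfl⟩ := clMk_surj x
  simpa using main y 1 hone

/-- Induction in the Hecke-Clifford algebra by right multiplication by generators. -/
lemma hc_induction {q : R} {P : HA R q r → Prop} (x : HA R q r) (hone : P 1)
    (hadd : ∀ x y, P x → P y → P (x + y)) (hsmul : ∀ (a : R) x, P x → P (a • x))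
    (hT : ∀ x i, P x → P (x * tA R q r i))
    (hC : ∀ x j, P x → P (x * cA R q r j)) : P x := by
  have main : ∀ y : FreeAlgebra R (Gen r), ∀ z, P z →
      P (z * hcMk R q r y) := by
    intro y
    induction y using FreeAlgebra.induction with
    | grade0 a =>
      intro z hz
      rw [AlgHom.commutes, ← Algebra.commutes, ← Algebra.smul_def]
      exact hsmul _ _ hz
    | grade1 j =>
      intro z hz
      cases j with
      | inl i => exact hT _ _ hz
      | inr j => exact hC _ _ hz
    | mul a b ha hb =>
      intro z hz
      rw [map_mul, ← mul_assoc]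
      exact hb _ (ha _ hz)
    | add a b ha hb =>
      intro z hz
      rw [map_add, mul_add]
      exact hadd _ _ (ha _ hz) (hb _ hz)
  obtain ⟨y, rfl⟩ := hcMk_surj x
  simpa using main y 1 hone

section Rel
variable {q : R}

lemma CC_sq (j : Fin r) : cA R q r j * cA R q r j = -1 := by
  have := hcMk_rel (HCRel.csq (R := R) (q := q) j)
  simpa [hcMk_C] using this

lemma CC_anti (i j : Fin r) (h : i ≠ j) : cA R q r i * cA R q r j = -(cA R q r j * cA R q r i) := by
  have := hcMk_rel (HCRel.canti (R := R) (q := q) i j h)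
  simpa [hcMk_C] using this

lemma TT_sq (i : Fin (r - 1)) : tA R q r i * tA R q r i = (q - 1) • tA R q r i + q • 1 := by
  have := hcMk_rel (HCRel.quad (R := R) (q := q) i)
  simp only [map_mul, map_sub, map_add, map_one, map_zero, AlgHom.commutes] at this
  rw [hcMk_T] at this
  rw [sub_mul, mul_add, mul_add, mul_one, mul_one, Algebra.algebraMap_eq_smul_one,
    smul_mul_assoc, one_mul, sub_eq_zero] at this
  rw [sub_smul, one_smul, eq_sub_of_add_eq this]
  abel

lemma TC_comm (i : Fin (r - 1)) (j : Fin r) (h1 : j ≠ loIdx i) (h2 : j ≠ hiIdx i) :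
    tA R q r i * cA R q r j = cA R q r j * tA R q r i := by
  have := hcMk_rel (HCRel.commTC (R := R) (q := q) i j
    (fun h => h1 (Fin.ext h)) (fun h => h2 (Fin.ext h)))
  simpa [hcMk_C, hcMk_T] using this

lemma TC_lo (i : Fin (r - 1)) :
    tA R q r i * cA R q r (loIdx i) = cA R q r (hiIdx i) * tA R q r i := by
  have := hcMk_rel (HCRel.TClo (R := R) (q := q) i)
  simpa [hcMk_C, hcMk_T] using this

lemma TC_hi (i : Fin (r - 1)) :
    tA R q r i * cA R q r (hiIdx i) = cA R q r (loIdx i) * tA R q r i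
      - (q - 1) • (cA R q r (loIdx i) - cA R q r (hiIdx i)) := by
  have := hcMk_rel (HCRel.TChi (R := R) (q := q) i)
  simp only [map_mul, map_sub (hcMk R q r), AlgHom.commutes, hcMk_T, hcMk_C] at this
  rw [Algebra.smul_def]
  exact this

end Rel

/-- The canonical map from the Clifford algebra. -/
def clPi (R : Type) [CommRing R] (q : R) (r : ℕ) : Cl R r →ₐ[R] HA R q r :=
  clLift (cA R q r) CC_sq CC_anti

lemma clPi_cg {q : R} (j : Fin r) : clPi R q r (cg R r j) = cA R q r j := clLift_cg _ _ _ j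

/-- The derivation on generators. -/
def dg (q : R) (k : Fin (r - 1)) (j : Fin r) : Cl R r :=
  if j = loIdx k then (q - 1) • (cg R r (loIdx k) - cg R r (hiIdx k)) else 0

/-- Matrix encoding of the automorphism and twisted derivation. -/
def matGen (q : R) (k : Fin (r - 1)) (j : Fin r) : Matrix (Fin 2) (Fin 2) (Cl R r) :=
  !![cg R r j, dg q k j; 0, cg R r (simpleT k j)]

lemma simpleT_other (k : Fin (r - 1)) {j : Fin r} (h1 : j ≠ loIdx k) (h2 : j ≠ hiIdx k) :
    simpleT k j = j := Equiv.swap_apply_of_ne_of_ne h1 h2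

lemma dg_sq (q : R) (k : Fin (r - 1)) (i : Fin r) :
    cg R r i * dg q k i + dg q k i * cg R r (simpleT k i) = 0 := by
  unfold dg
  split_ifs with h
  · subst h
    rw [simpleT_lo, mul_smul_comm, smul_mul_assoc, ← smul_add, mul_sub, sub_mul, cg_sq, cg_sq]
    module
  · simp

lemma dg_anti (q : R) (k : Fin (r - 1)) (i j : Fin r) (h : i ≠ j) :
    cg R r i * dg q k j + dg q k i * cg R r (simpleT k j)
      = -(cg R r j * dg q k i + dg q k j * cg R r (simpleT k i)) := by
  wlog hi : i = loIdx k generalizing i j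
  · by_cases hj : j = loIdx k
    · rw [this j i h.symm hj, neg_neg]
    · simp [dg, hi, hj]
  subst hi
  have hj : j ≠ loIdx k := h.symm
  simp only [dg, if_true, if_neg hj, mul_zero, zero_mul, zero_add, add_zero, mul_smul_comm,
    smul_mul_assoc, ← smul_neg]
  congr 1
  by_cases hj2 : j = hiIdx k
  · subst hj2
    rw [simpleT_hi, mul_sub, sub_mul, cg_sq, cg_sq]
    abel
  · rw [simpleT_other k hj hj2, sub_mul, mul_sub, cg_anti _ _ h, cg_anti _ _ (Ne.symm hj2)]
    abel

/-- The algebra map encoding automorphism and twisted derivation. -/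
def matHom (q : R) (k : Fin (r - 1)) : Cl R r →ₐ[R] Matrix (Fin 2) (Fin 2) (Cl R r) :=
  clLift (matGen q k)
    (by
      intro j
      have := dg_sq q k j
      ext a b
      fin_cases a <;> fin_cases b <;>
        simp [matGen, Matrix.mul_apply, Fin.sum_univ_two, cg_sq, this])
    (by
      intro i j h
      have := dg_anti q k i j h
      have h' : simpleT k i ≠ simpleT k j := fun e => h ((simpleT k).injective e)
      ext a b
      fin_cases a <;> fin_cases b
      · simpa [matGen, Matrix.mul_apply, Fin.sum_univ_two] using cg_anti i j h
      · simpa [matGen, Matrix.mul_apply, Fin.sum_univ_two, add_comm] using this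
      · simp [matGen, Matrix.mul_apply, Fin.sum_univ_two]
      · simpa [matGen, Matrix.mul_apply, Fin.sum_univ_two] using cg_anti _ _ h')

lemma matHom_cg (q : R) (k : Fin (r - 1)) (j : Fin r) : matHom q k (cg R r j) = matGen q k j :=
  clLift_cg _ _ _ j

lemma matHom_00 (q : R) (k : Fin (r - 1)) (x : Cl R r) :
    matHom q k x 0 0 = x ∧ matHom q k x 1 0 = 0 := by
  induction x using cl_induction with
  | hone => simp
  | hadd x y hx hy => simp [hx, hy]
  | hsmul a x hx => simp [hx]
  | hmul x j hx => simp [hx, matHom_cg, matGen, Matrix.mul_apply, Fin.sum_univ_two]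

/-- The automorphism. -/
def sg (q : R) (k : Fin (r - 1)) : Cl R r →ₗ[R] Cl R r where
  toFun x := matHom q k x 1 1
  map_add' x y := by simp
  map_smul' a x := by simp

/-- The twisted derivation. -/
def dl (q : R) (k : Fin (r - 1)) : Cl R r →ₗ[R] Cl R r where
  toFun x := matHom q k x 0 1
  map_add' x y := by simp
  map_smul' a x := by simp

lemma sg_one (q : R) (k : Fin (r - 1)) : sg q k (1 : Cl R r) = 1 := by simp [sg]
lemma dl_one (q : R) (k : Fin (r - 1)) : dl q k (1 : Cl R r) = 0 := by simp [dl]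

lemma sg_mul (q : R) (k : Fin (r - 1)) (x : Cl R r) (j : Fin r) :
    sg q k (x * cg R r j) = sg q k x * cg R r (simpleT k j) := by
  simp [sg, matHom_cg, matGen, Matrix.mul_apply, Fin.sum_univ_two, (matHom_00 q k x).2]

lemma dl_mul (q : R) (k : Fin (r - 1)) (x : Cl R r) (j : Fin r) :
    dl q k (x * cg R r j) = x * dg q k j + dl q k x * cg R r (simpleT k j) := by
  simp [dl, matHom_cg, matGen, Matrix.mul_apply, Fin.sum_univ_two, (matHom_00 q k x).1]

lemma CT (q : R) (k : Fin (r - 1)) (j : Fin r) :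
    cA R q r j * tA R q r k = tA R q r k * cA R q r (simpleT k j) + clPi R q r (dg q k j) := by
  by_cases h1 : j = loIdx k
  · subst h1
    rw [simpleT_lo, TC_hi, dg, if_pos rfl]
    simp [clPi_cg]
  · rw [dg, if_neg h1, map_zero, add_zero]
    by_cases h2 : j = hiIdx k
    · subst h2
      rw [simpleT_hi, TC_lo]
    · rw [simpleT_other k h1 h2, TC_comm k j h1 h2]

lemma clPi_T (q : R) (k : Fin (r - 1)) (x : Cl R r) :
    clPi R q r x * tA R q r k
      = tA R q r k * clPi R q r (sg q k x) + clPi R q r (dl q k x) := by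
  induction x using cl_induction with
  | hone => simp [sg_one, dl_one]
  | hadd x y hx hy => simp only [map_add, add_mul, mul_add, hx, hy]; abel
  | hsmul a x hx => simp [hx]
  | hmul x j hx =>
    rw [sg_mul, dl_mul, map_mul, map_mul, map_add, map_mul, map_mul, clPi_cg, clPi_cg,
      mul_assoc, CT, mul_add, ← mul_assoc, hx]
    noncomm_ring

end

end

end HCPaper
set_option linter.all false

namespace HCPaper

section Abs

variable {R E : Type} [CommRing R] [Ring E] [Algebra R E]

/-- The quadratic expression intertwines. -/
lemma abs_quad (p q : R) (T a b : E) (ha : T * a = b * T + p • (a - b)) (hb : T * b = a * T) :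
    (T * T - (p • T + q • 1)) * a = a * (T * T - (p • T + q • 1)) ∧
    (T * T - (p • T + q • 1)) * b = b * (T * T - (p • T + q • 1)) := by
  have ha' : ∀ x, T * (a * x) = b * (T * x) + p • (a * x - b * x) := fun x => by
    rw [← mul_assoc, ha]; simp only [add_mul, smul_mul_assoc, sub_mul, mul_assoc]
  have hb' : ∀ x, T * (b * x) = a * (T * x) := fun x => by
    rw [← mul_assoc, hb, mul_assoc]
  constructor <;>
  · simp only [mul_sub, sub_mul, mul_add, add_mul, smul_mul_assoc, mul_smul_comm, mul_assoc, ha, hb,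
      ha', hb', one_mul, mul_one]
    module

lemma abs_neg (X Y u v : E) (h : (X - Y) * u = v * (X - Y)) : (Y - X) * u = v * (Y - X) := by
  rw [← neg_sub X Y, neg_mul, h, mul_neg]

lemma abs_comm_other (T x : E) (p q : R) (h : T * x = x * T) :
    (T * T - (p • T + q • 1)) * x = x * (T * T - (p • T + q • 1)) := by
  have h' : ∀ y, T * (x * y) = x * (T * y) := fun y => by
    rw [← mul_assoc, h, mul_assoc]
  simp only [mul_sub, sub_mul, mul_add, add_mul, smul_mul_assoc, mul_smul_comm, mul_assoc, h, h',
      one_mul, mul_one]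

/-- The braid expression intertwines. -/
lemma abs_braid (p q : R) (T S a b c : E)
    (hTT : T * T = p • T + q • 1) (hSS : S * S = p • S + q • 1)
    (Ta : T * a = b * T + p • (a - b)) (Tb : T * b = a * T) (Tc : T * c = c * T)
    (Sb : S * b = c * S + p • (b - c)) (Sc : S * c = b * S) (Sa : S * a = a * S) :
    (T * S * T - S * T * S) * a = c * (T * S * T - S * T * S) ∧
    (T * S * T - S * T * S) * b = b * (T * S * T - S * T * S) ∧
    (T * S * T - S * T * S) * c = a * (T * S * T - S * T * S) := by
  have hTT' : ∀ x, T * (T * x) = p • (T * x) + q • x := fun x => by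
    rw [← mul_assoc, hTT]; simp only [add_mul, smul_mul_assoc, one_mul]
  have hSS' : ∀ x, S * (S * x) = p • (S * x) + q • x := fun x => by
    rw [← mul_assoc, hSS]; simp only [add_mul, smul_mul_assoc, one_mul]
  have Ta' : ∀ x, T * (a * x) = b * (T * x) + p • (a * x - b * x) := fun x => by
    rw [← mul_assoc, Ta]; simp only [add_mul, smul_mul_assoc, sub_mul, mul_assoc]
  have Tb' : ∀ x, T * (b * x) = a * (T * x) := fun x => by rw [← mul_assoc, Tb, mul_assoc]
  have Tc' : ∀ x, T * (c * x) = c * (T * x) := fun x => by rw [← mul_assoc, Tc, mul_assoc]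
  have Sb' : ∀ x, S * (b * x) = c * (S * x) + p • (b * x - c * x) := fun x => by
    rw [← mul_assoc, Sb]; simp only [add_mul, smul_mul_assoc, sub_mul, mul_assoc]
  have Sc' : ∀ x, S * (c * x) = b * (S * x) := fun x => by rw [← mul_assoc, Sc, mul_assoc]
  have Sa' : ∀ x, S * (a * x) = a * (S * x) := fun x => by rw [← mul_assoc, Sa, mul_assoc]
  refine ⟨?_, ?_, ?_⟩ <;>
  · simp only [mul_sub, sub_mul, mul_add, add_mul, smul_mul_assoc, mul_smul_comm, mul_assoc,
      hTT, hSS, hTT', hSS', Ta, Tb, Tc, Sa, Sb, Sc, Ta', Tb', Tc', Sa', Sb', Sc',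
      one_mul, mul_one, smul_add, smul_sub]
    try module

lemma abs_braid_other (T S x : E) (hT : T * x = x * T) (hS : S * x = x * S) :
    (T * S * T - S * T * S) * x = x * (T * S * T - S * T * S) := by
  have hT' : ∀ y, T * (x * y) = x * (T * y) := fun y => by rw [← mul_assoc, hT, mul_assoc]
  have hS' : ∀ y, S * (x * y) = x * (S * y) := fun y => by rw [← mul_assoc, hS, mul_assoc]
  simp only [mul_sub, sub_mul, mul_assoc, hT, hS, hT', hS']

/-- The commutator intertwines. -/
lemma abs_comm (p : R) (T S a b : E)
    (Ta : T * a = b * T + p • (a - b)) (Tb : T * b = a * T)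
    (Sb : S * b = b * S) (Sa : S * a = a * S) :
    (T * S - S * T) * a = b * (T * S - S * T) ∧
    (T * S - S * T) * b = a * (T * S - S * T) := by
  have Ta' : ∀ x, T * (a * x) = b * (T * x) + p • (a * x - b * x) := fun x => by
    rw [← mul_assoc, Ta]; simp only [add_mul, smul_mul_assoc, sub_mul, mul_assoc]
  have Tb' : ∀ x, T * (b * x) = a * (T * x) := fun x => by rw [← mul_assoc, Tb, mul_assoc]
  have Sb' : ∀ x, S * (b * x) = b * (S * x) := fun x => by rw [← mul_assoc, Sb, mul_assoc]
  have Sa' : ∀ x, S * (a * x) = a * (S * x) := fun x => by rw [← mul_assoc, Sa, mul_assoc]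
  refine ⟨?_, ?_⟩ <;>
  · simp only [mul_sub, sub_mul, mul_add, add_mul, smul_mul_assoc, mul_smul_comm, mul_assoc,
      Ta, Tb, Sa, Sb, Ta', Tb', Sa', Sb', smul_sub]
    try module

lemma abs_comm_other' (T S x : E) (hT : T * x = x * T) (hS : S * x = x * S) :
    (T * S - S * T) * x = x * (T * S - S * T) := by
  have hT' : ∀ y, T * (x * y) = x * (T * y) := fun y => by rw [← mul_assoc, hT, mul_assoc]
  have hS' : ∀ y, S * (x * y) = x * (S * y) := fun y => by rw [← mul_assoc, hS, mul_assoc]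
  simp only [mul_sub, sub_mul, mul_assoc, hT, hS, hT', hS']

end Abs

section RO

variable {R : Type} [CommRing R] {r : ℕ} {M : Type} [AddCommGroup M] [Module R M]

/-- The right Hecke operator on functions on the symmetric group. -/
def ro (q : R) (x y : Fin r) : (Equiv.Perm (Fin r) → M) →ₗ[R] (Equiv.Perm (Fin r) → M) where
  toFun f w := if w x < w y then q • f (w * Equiv.swap x y)
    else f (w * Equiv.swap x y) + (q - 1) • f w
  map_add' f g := by
    ext w
    simp only [Pi.add_apply]
    split_ifs <;> module
  map_smul' a f := by
    ext w
    simp only [Pi.smul_apply, RingHom.id_apply]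
    split_ifs <;> module

lemma ro_up (q : R) {x y : Fin r} (f : Equiv.Perm (Fin r) → M) {w : Equiv.Perm (Fin r)}
    (h : w x < w y) : ro q x y f w = q • f (w * Equiv.swap x y) := if_pos h

lemma ro_down (q : R) {x y : Fin r} (f : Equiv.Perm (Fin r) → M) {w : Equiv.Perm (Fin r)}
    (h : w y < w x) : ro q x y f w = f (w * Equiv.swap x y) + (q - 1) • f w := if_neg h.asymm

lemma ro_quad (q : R) {x y : Fin r} (hxy : x ≠ y) (f : Equiv.Perm (Fin r) → M) :
    ro q x y (ro q x y f) = (q - 1) • ro q x y f + q • f := by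
  ext w
  rcases lt_or_gt_of_ne (w.injective.ne hxy) with h | h
  · have h' : (w * Equiv.swap x y) y < (w * Equiv.swap x y) x := by simpa using h
    simp only [Pi.add_apply, Pi.smul_apply, ro_up q _ h, ro_down q _ h', mul_assoc,
      Equiv.swap_mul_self, mul_one]
    module
  · have h' : (w * Equiv.swap x y) x < (w * Equiv.swap x y) y := by simpa using h
    simp only [Pi.add_apply, Pi.smul_apply, ro_down q _ h, ro_up q _ h', mul_assoc,
      Equiv.swap_mul_self, mul_one]
    module

lemma ro_comm (q : R) {x y z t : Fin r} (hxy : x ≠ y) (hzt : z ≠ t)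
    (hxz : x ≠ z) (hxt : x ≠ t) (hyz : y ≠ z) (hyt : y ≠ t) (f : Equiv.Perm (Fin r) → M) :
    ro q x y (ro q z t f) = ro q z t (ro q x y f) := by
  have hsw : ∀ w : Equiv.Perm (Fin r),
      w * Equiv.swap x y * Equiv.swap z t = w * Equiv.swap z t * Equiv.swap x y := by
    intro w
    rw [mul_assoc, mul_assoc]
    congr 1
    ext u
    simp only [Equiv.Perm.coe_mul, Function.comp_apply, Equiv.swap_apply_def]
    split_ifs <;> simp_all
  have e1 : ∀ w : Equiv.Perm (Fin r), (w * Equiv.swap x y) z = w z := fun w => by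
    simp [Equiv.swap_apply_of_ne_of_ne hxz.symm hyz.symm]
  have e2 : ∀ w : Equiv.Perm (Fin r), (w * Equiv.swap x y) t = w t := fun w => by
    simp [Equiv.swap_apply_of_ne_of_ne hxt.symm hyt.symm]
  have e3 : ∀ w : Equiv.Perm (Fin r), (w * Equiv.swap z t) x = w x := fun w => by
    simp [Equiv.swap_apply_of_ne_of_ne hxz hxt]
  have e4 : ∀ w : Equiv.Perm (Fin r), (w * Equiv.swap z t) y = w y := fun w => by
    simp [Equiv.swap_apply_of_ne_of_ne hyz hyt]
  ext w
  change (if _ then _ else _) = (if _ then _ else _)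
  simp only [ro, LinearMap.coe_mk, AddHom.coe_mk, e1, e2, e3, e4, hsw]
  split_ifs <;> module

lemma ro_braid (q : R) {x y z : Fin r} (hxy : x ≠ y) (hxz : x ≠ z) (hyz : y ≠ z)
    (f : Equiv.Perm (Fin r) → M) :
    ro q x y (ro q y z (ro q x y f)) = ro q y z (ro q x y (ro q y z f)) := by
  have hsw : ∀ w : Equiv.Perm (Fin r),
      w * Equiv.swap y z * Equiv.swap x y * Equiv.swap y z
        = w * Equiv.swap x y * Equiv.swap y z * Equiv.swap x y := by
    intro w
    simp only [mul_assoc]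
    congr 1
    ext u
    simp only [Equiv.Perm.coe_mul, Function.comp_apply, Equiv.swap_apply_def]
    split_ifs <;> simp_all
  have s1 : ∀ w : Equiv.Perm (Fin r), w * Equiv.swap x y * Equiv.swap x y = w := by
    simp [mul_assoc]
  have s2 : ∀ w : Equiv.Perm (Fin r), w * Equiv.swap y z * Equiv.swap y z = w := by
    simp [mul_assoc]
  have e1 : ∀ w : Equiv.Perm (Fin r), (w * Equiv.swap x y) x = w y := by simp
  have e2 : ∀ w : Equiv.Perm (Fin r), (w * Equiv.swap x y) y = w x := by simp
  have e3 : ∀ w : Equiv.Perm (Fin r), (w * Equiv.swap x y) z = w z := fun w => by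
    simp [Equiv.swap_apply_of_ne_of_ne hxz.symm hyz.symm]
  have e4 : ∀ w : Equiv.Perm (Fin r), (w * Equiv.swap y z) x = w x := fun w => by
    simp [Equiv.swap_apply_of_ne_of_ne hxy hxz]
  have e5 : ∀ w : Equiv.Perm (Fin r), (w * Equiv.swap y z) y = w z := by simp
  have e6 : ∀ w : Equiv.Perm (Fin r), (w * Equiv.swap y z) z = w y := by simp
  ext w
  change (if _ then _ else _) = (if _ then _ else _)
  simp only [ro, LinearMap.coe_mk, AddHom.coe_mk, e1, e2, e3, e4, e5, e6, s1, s2, hsw]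
  have n1 := w.injective.ne hxy
  have n2 := w.injective.ne hxz
  have n3 := w.injective.ne hyz
  rcases lt_or_gt_of_ne n1 with h1 | h1 <;> rcases lt_or_gt_of_ne n2 with h2 | h2 <;>
    rcases lt_or_gt_of_ne n3 with h3 | h3 <;>
    first
    | (exfalso; order)
    | (simp only [h1, h2, h3, h1.asymm, h2.asymm, h3.asymm, if_true, if_false]; try module)

end RO

end HCPaper
namespace HCPaper

noncomputable section

section Rep

variable {R : Type} [CommRing R] {r : ℕ}

/-- The underlying space of the regular representation. -/
abbrev VV (R : Type) [CommRing R] (r : ℕ) : Type := Equiv.Perm (Fin r) → Cl R r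

/-- Right multiplication by a Clifford generator. -/
def cOp (R : Type) [CommRing R] {r : ℕ} (j : Fin r) : Module.End R (VV R r) where
  toFun f w := f w * cg R r j
  map_add' f g := by ext w; simp [add_mul]
  map_smul' a f := by ext w; simp

/-- Right multiplication by a Hecke generator. -/
def tOp (q : R) (k : Fin (r - 1)) : Module.End R (VV R r) where
  toFun f w := sg q k (ro q (loIdx k) (hiIdx k) f w) + dl q k (f w)
  map_add' f g := by ext w; simp only [map_add, Pi.add_apply]; abel
  map_smul' a f := by ext w; simp

lemma cOp_apply (j : Fin r) (f : VV R r) (w) : cOp R j f w = f w * cg R r j := rfl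

lemma tOp_apply (q : R) (k : Fin (r - 1)) (f : VV R r) (w) :
    tOp q k f w = sg q k (ro q (loIdx k) (hiIdx k) f w) + dl q k (f w) := rfl

lemma ro_cOp (q : R) (x y : Fin r) (j : Fin r) (f : VV R r) (w) :
    ro q x y (cOp R j f) w = ro q x y f w * cg R r j := by
  simp only [ro, LinearMap.coe_mk, AddHom.coe_mk, cOp_apply]
  split_ifs <;> simp [add_mul]

lemma tOp_cOp_apply (q : R) (k : Fin (r - 1)) (j : Fin r) (f : VV R r) (w) :
    tOp q k (cOp R j f) w = tOp q k f w * cg R r (simpleT k j) + f w * dg q k j := by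
  rw [tOp_apply, tOp_apply, ro_cOp, sg_mul, cOp_apply, dl_mul, add_mul]
  abel

lemma tOp_lo (q : R) (k : Fin (r - 1)) :
    tOp q k * cOp R (loIdx k) = cOp R (hiIdx k) * tOp q k
      + (q - 1) • (cOp R (loIdx k) - cOp R (hiIdx k)) := by
  refine LinearMap.ext fun f => funext fun w => ?_
  simp only [Module.End.mul_apply, LinearMap.add_apply, Pi.add_apply, LinearMap.smul_apply,
    Pi.smul_apply, LinearMap.sub_apply, Pi.sub_apply, tOp_cOp_apply, cOp_apply, simpleT_lo, dg,
    if_true, mul_smul_comm, mul_sub]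

lemma tOp_hi (q : R) (k : Fin (r - 1)) :
    tOp q k * cOp R (hiIdx k) = cOp R (loIdx k) * tOp q k := by
  refine LinearMap.ext fun f => funext fun w => ?_
  simp only [Module.End.mul_apply, tOp_cOp_apply, cOp_apply, simpleT_hi, dg,
    if_neg (lo_ne_hi k).symm, mul_zero, add_zero]

lemma tOp_other (q : R) (k : Fin (r - 1)) {j : Fin r} (h1 : j ≠ loIdx k) (h2 : j ≠ hiIdx k) :
    tOp q k * cOp R j = cOp R j * tOp q k := by
  refine LinearMap.ext fun f => funext fun w => ?_
  simp only [Module.End.mul_apply, tOp_cOp_apply, cOp_apply, simpleT_other k h1 h2, dg,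
    if_neg h1, mul_zero, add_zero]

/-- Embedding of scalar functions. -/
def emb (g : Equiv.Perm (Fin r) → R) : VV R r := fun w => g w • 1

lemma tOp_emb (q : R) (k : Fin (r - 1)) (g : Equiv.Perm (Fin r) → R) :
    tOp q k (emb g) = emb (ro q (loIdx k) (hiIdx k) g) := by
  ext w
  rw [tOp_apply]
  simp only [ro, LinearMap.coe_mk, AddHom.coe_mk, emb]
  split_ifs <;> simp only [map_add, map_smul, sg_one, dl_one, smul_eq_mul] <;> module

lemma eq_zero_of_intertwine (X : Module.End R (VV R r)) (h0 : ∀ g, X (emb g) = 0)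
    (h : ∀ j, ∃ Y : Module.End R (VV R r), X * cOp R j = Y * X) : X = 0 := by
  classical
  have h1 : ∀ (x : Cl R r) (w : Equiv.Perm (Fin r)), X (Pi.single w x) = 0 := by
    intro x w
    induction x using cl_induction with
    | hone =>
      rw [← h0 (Pi.single w 1)]
      congr 1
      ext v
      by_cases hv : v = w
      · subst hv; simp [emb]
      · simp [emb, hv]
    | hadd x y hx hy => rw [Pi.single_add, map_add, hx, hy, add_zero]
    | hsmul a x hx => rw [Pi.single_smul, map_smul, hx, smul_zero]
    | hmul x j hx =>
      obtain ⟨Y, hY⟩ := h j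
      have e : (Pi.single w (x * cg R r j) : VV R r) = cOp R j (Pi.single w x) := by
        ext v
        rw [cOp_apply]
        by_cases hv : v = w
        · subst hv; simp
        · simp [hv]
      rw [e, ← Module.End.mul_apply, hY, Module.End.mul_apply, hx, map_zero]
  apply LinearMap.ext
  intro f
  rw [← Finset.univ_sum_single f, map_sum]
  simp [h1]

lemma tOp_quad (q : R) (k : Fin (r - 1)) :
    tOp q k * tOp q k = (q - 1) • tOp q k + q • (1 : Module.End R (VV R r)) := by
  rw [← sub_eq_zero]
  apply eq_zero_of_intertwine
  · intro g
    simp only [LinearMap.sub_apply, LinearMap.add_apply, LinearMap.smul_apply,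
      Module.End.mul_apply, tOp_emb, Module.End.one_apply, ro_quad q (lo_ne_hi k)]
    ext w
    simp only [Pi.sub_apply, Pi.add_apply, Pi.smul_apply, emb, Pi.zero_apply, smul_eq_mul]
    module
  · intro j
    have := abs_quad (q - 1) q (tOp q k) _ _ (tOp_lo q k) (tOp_hi q k)
    by_cases h1 : j = loIdx k
    · subst h1; exact ⟨_, this.1⟩
    by_cases h2 : j = hiIdx k
    · subst h2; exact ⟨_, this.2⟩
    · exact ⟨_, abs_comm_other (tOp q k) (cOp R j) (q - 1) q (tOp_other q k h1 h2)⟩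

lemma tOp_comm (q : R) (k l : Fin (r - 1)) (h : k.val + 1 < l.val) :
    tOp q k * tOp q l = tOp q l * tOp q k := by
  have a1 : loIdx k ≠ loIdx l := by simp only [loIdx, Ne, Fin.ext_iff]; omega
  have a2 : loIdx k ≠ hiIdx l := by simp only [loIdx, hiIdx, Ne, Fin.ext_iff]; omega
  have a3 : hiIdx k ≠ loIdx l := by simp only [loIdx, hiIdx, Ne, Fin.ext_iff]; omega
  have a4 : hiIdx k ≠ hiIdx l := by simp only [hiIdx, Ne, Fin.ext_iff]; omega
  rw [← sub_eq_zero]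
  apply eq_zero_of_intertwine
  · intro g
    simp only [LinearMap.sub_apply, Module.End.mul_apply, tOp_emb,
      ro_comm q (lo_ne_hi k) (lo_ne_hi l) a1 a2 a3 a4, sub_self]
  · intro j
    have h1 := abs_comm (q - 1) (tOp q k) (tOp q l) _ _ (tOp_lo q k) (tOp_hi q k)
      (tOp_other q l a3 a4) (tOp_other q l a1 a2)
    have h2 := abs_comm (q - 1) (tOp q l) (tOp q k) _ _ (tOp_lo q l) (tOp_hi q l)
      (tOp_other q k a2.symm a4.symm) (tOp_other q k a1.symm a3.symm)
    by_cases c1 : j = loIdx k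
    · subst c1; exact ⟨_, h1.1⟩
    by_cases c2 : j = hiIdx k
    · subst c2; exact ⟨_, h1.2⟩
    by_cases c3 : j = loIdx l
    · subst c3; exact ⟨_, abs_neg _ _ _ _ h2.1⟩
    by_cases c4 : j = hiIdx l
    · subst c4; exact ⟨_, abs_neg _ _ _ _ h2.2⟩
    exact ⟨_, abs_comm_other' _ _ _ (tOp_other q k c1 c2) (tOp_other q l c3 c4)⟩

lemma tOp_braid (q : R) (k l : Fin (r - 1)) (h : l.val = k.val + 1) :
    tOp q k * tOp q l * tOp q k = tOp q l * tOp q k * tOp q l := by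
  have e : loIdx l = hiIdx k := by simp [loIdx, hiIdx, h]
  have a1 : loIdx k ≠ hiIdx l := by simp only [loIdx, hiIdx, Ne, Fin.ext_iff]; omega
  have a2 : loIdx k ≠ loIdx l := by simp only [loIdx, Ne, Fin.ext_iff]; omega
  have a4 : hiIdx k ≠ hiIdx l := by simp only [hiIdx, Ne, Fin.ext_iff]; omega
  rw [← sub_eq_zero]
  apply eq_zero_of_intertwine
  · intro g
    simp only [LinearMap.sub_apply, Module.End.mul_apply, tOp_emb, e,
      ro_braid q (lo_ne_hi k) a1 a4, sub_self]
  · intro j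
    have hl := tOp_lo q l
    have hh := tOp_hi q l
    rw [e] at hl hh
    have h1 := abs_braid (q - 1) q (tOp q k) (tOp q l) _ _ _ (tOp_quad q k) (tOp_quad q l)
      (tOp_lo q k) (tOp_hi q k) (tOp_other q k a1.symm a4.symm) hl hh (tOp_other q l a2 a1)
    by_cases c1 : j = loIdx k
    · subst c1; exact ⟨_, h1.1⟩
    by_cases c2 : j = hiIdx k
    · subst c2; exact ⟨_, h1.2.1⟩
    by_cases c3 : j = hiIdx l
    · subst c3; exact ⟨_, h1.2.2⟩
    exact ⟨_, abs_braid_other _ _ _ (tOp_other q k c1 c2) (tOp_other q l (e ▸ c2) c3)⟩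

/-- Images of generators. -/
def repGen (q : R) : Gen r → (Module.End R (VV R r))ᵐᵒᵖ
  | Sum.inl i => MulOpposite.op (tOp q i)
  | Sum.inr j => MulOpposite.op (cOp R j)

lemma repGen_rel (q : R) ⦃x y : FreeAlgebra R (Gen r)⦄ (h : HCRel R q r x y) :
    FreeAlgebra.lift R (repGen q) x = FreeAlgebra.lift R (repGen q) y := by
  cases h with
  | csq j =>
    simp only [Cf, map_mul, map_neg, map_one, FreeAlgebra.lift_ι_apply, repGen]
    apply MulOpposite.unop_injective
    refine LinearMap.ext fun f => funext fun w => ?_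
    simp [cOp_apply, mul_assoc, cg_sq]
  | canti i j h =>
    simp only [Cf, map_mul, map_neg, FreeAlgebra.lift_ι_apply, repGen]
    apply MulOpposite.unop_injective
    refine LinearMap.ext fun f => funext fun w => ?_
    simp [cOp_apply, mul_assoc, cg_anti _ _ h.symm]
  | quad i =>
    simp only [Tf, map_mul, map_sub, map_add, map_one, map_zero, FreeAlgebra.lift_ι_apply, repGen,
      AlgHom.commutes]
    apply MulOpposite.unop_injective
    simp only [MulOpposite.unop_mul, MulOpposite.unop_sub, MulOpposite.unop_add,
      MulOpposite.unop_op, MulOpposite.unop_one, MulOpposite.unop_zero,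
      MulOpposite.algebraMap_apply, Algebra.algebraMap_eq_smul_one]
    simp only [MulOpposite.unop_smul, MulOpposite.unop_one, add_mul, mul_sub, one_mul, mul_smul_comm, mul_one, tOp_quad]
    module
  | commTT i i' h =>
    simp only [Tf, map_mul, FreeAlgebra.lift_ι_apply, repGen, ← MulOpposite.op_mul,
      tOp_comm q i i' h]
  | braid i i' h =>
    simp only [Tf, map_mul, FreeAlgebra.lift_ι_apply, repGen, ← MulOpposite.op_mul, ← mul_assoc,
      tOp_braid q i i' h]
  | commTC i j h1 h2 =>
    simp only [Tf, Cf, map_mul, FreeAlgebra.lift_ι_apply, repGen, ← MulOpposite.op_mul]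
    rw [tOp_other q i (fun e => h1 (congrArg Fin.val e)) (fun e => h2 (congrArg Fin.val e))]
  | TClo i =>
    simp only [Tf, Cf, map_mul, FreeAlgebra.lift_ι_apply, repGen, ← MulOpposite.op_mul, tOp_hi]
  | TChi i =>
    simp only [Tf, Cf, map_mul, map_sub (FreeAlgebra.lift R (repGen q)), FreeAlgebra.lift_ι_apply,
      repGen, AlgHom.commutes]
    simp only [← Algebra.smul_def]
    apply MulOpposite.unop_injective
    simp only [MulOpposite.unop_mul, MulOpposite.unop_sub, MulOpposite.unop_smul,
      MulOpposite.unop_op, tOp_lo]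
    abel

/-- The right regular representation. -/
def rep (q : R) : HA R q r →ₐ[R] (Module.End R (VV R r))ᵐᵒᵖ :=
  (RingQuot.liftAlgHom R ⟨FreeAlgebra.lift R (repGen q), repGen_rel q⟩ :
    RingQuot (HCRel R q r) →ₐ[R] _)

lemma rep_mk (q : R) (x : FreeAlgebra R (Gen r)) :
    rep q (hcMk R q r x) = FreeAlgebra.lift R (repGen q) x :=
  RingQuot.liftAlgHom_mkAlgHom_apply R (FreeAlgebra.lift R (repGen q)) (repGen_rel q) x

lemma rep_T (q : R) (k : Fin (r - 1)) : rep q (tA R q r k) = MulOpposite.op (tOp q k) := by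
  rw [← hcMk_T, rep_mk, Tf, FreeAlgebra.lift_ι_apply, repGen]

lemma rep_C (q : R) (j : Fin r) : rep q (cA R q r j) = MulOpposite.op (cOp R j) := by
  rw [← hcMk_C, rep_mk, Cf, FreeAlgebra.lift_ι_apply, repGen]

/-- The right action. -/
def act (q : R) (h : HA R q r) : Module.End R (VV R r) := (rep q h).unop

lemma act_mul (q : R) (h h' : HA R q r) (f : VV R r) : act q (h * h') f = act q h' (act q h f) := by
  simp [act]

lemma act_one (q : R) (f : VV R r) : act q 1 f = f := by simp [act]
lemma act_add (q : R) (h h' : HA R q r) (f : VV R r) :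
    act q (h + h') f = act q h f + act q h' f := by simp [act]
lemma act_smul (q : R) (a : R) (h : HA R q r) (f : VV R r) :
    act q (a • h) f = a • act q h f := by simp [act]
lemma act_T (q : R) (k : Fin (r - 1)) (f : VV R r) : act q (tA R q r k) f = tOp q k f := by
  simp [act, rep_T]
lemma act_C (q : R) (k : Fin r) (f : VV R r) : act q (cA R q r k) f = cOp R k f := by
  simp [act, rep_C]

end Rep

end

end HCPaper
namespace HCPaper

noncomputable section

section Left

variable {R : Type} [CommRing R] {r : ℕ}

/-- The left operator. -/
def lop (q : R) (k : Fin (r - 1)) (f : VV R r) : VV R r := fun w =>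
  if w⁻¹ (loIdx k) < w⁻¹ (hiIdx k) then q • f (simpleT k * w)
  else f (simpleT k * w) + (q - 1) • f w

lemma lop_cOp (q : R) (k : Fin (r - 1)) (j : Fin r) (f : VV R r) :
    lop q k (cOp R j f) = cOp R j (lop q k f) := by
  funext w
  simp only [lop, cOp_apply]
  split_ifs <;> simp [add_mul]

lemma lop_add (q : R) (k : Fin (r - 1)) (f g : VV R r) :
    lop q k (f + g) = lop q k f + lop q k g := by
  funext w
  simp only [lop, Pi.add_apply]
  split_ifs <;> module

lemma lop_smul (q : R) (k : Fin (r - 1)) (a : R) (g : VV R r) :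
    lop q k (a • g) = a • lop q k g := by
  funext w
  simp only [lop, Pi.smul_apply]
  split_ifs <;> module

/-- If neither order is exceptional. -/
lemma lt_iff_simpleT (i : Fin (r - 1)) {a b : Fin r} 
    (h1 : ¬ (a = loIdx i ∧ b = hiIdx i)) (h2 : ¬ (b = loIdx i ∧ a = hiIdx i)) :
    simpleT i a < simpleT i b ↔ a < b := by
  constructor
  · intro h
    by_contra h3
    rcases lt_or_eq_of_le (not_lt.1 h3) with h4 | h4
    · exact absurd (simpleT_lt i h4 h2) (by simpa using h.le)
    · rw [h4] at h; exact lt_irrefl _ h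
  · intro h; exact simpleT_lt i h h1

/-- Exceptional pairs. -/
lemma simpleT_conj (w : Equiv.Perm (Fin r)) (k i : Fin (r - 1))
    (h : (w (loIdx i) = loIdx k ∧ w (hiIdx i) = hiIdx k) ∨
      (w (loIdx i) = hiIdx k ∧ w (hiIdx i) = loIdx k)) :
    simpleT k * w = w * simpleT i := by
  have : w * simpleT i * w⁻¹ = simpleT k := by
    rw [simpleT, ← Equiv.swap_apply_apply]
    rcases h with h | h
    · rw [h.1, h.2, simpleT]
    · rw [h.1, h.2, Equiv.swap_comm, simpleT]
  rw [← this]; simp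

lemma lop_ro (q : R) (k i : Fin (r - 1)) (f : VV R r) :
    lop q k (ro q (loIdx i) (hiIdx i) f) = ro q (loIdx i) (hiIdx i) (lop q k f) := by
  funext w
  simp only [ro, lop, LinearMap.coe_mk, AddHom.coe_mk]
  rw [show Equiv.swap (loIdx i) (hiIdx i) = simpleT i from rfl]
  simp only [mul_inv_rev, Equiv.Perm.mul_apply, simpleT_inv]
  by_cases h : (w (loIdx i) = loIdx k ∧ w (hiIdx i) = hiIdx k) ∨
      (w (loIdx i) = hiIdx k ∧ w (hiIdx i) = loIdx k)
  · have e := simpleT_conj w k i h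
    have e2 : w * simpleT i * simpleT i = w := by rw [mul_assoc, simpleT_mul_self, mul_one]
    have lt := lo_lt_hi k
    have lt' := lo_lt_hi i
    rcases h with ⟨h1, h2⟩ | ⟨h1, h2⟩
    · have h3 : w⁻¹ (loIdx k) = loIdx i := by rw [← h1]; simp
      have h4 : w⁻¹ (hiIdx k) = hiIdx i := by rw [← h2]; simp
      simp only [← mul_assoc, e, e2, h1, h2, h3, h4, simpleT_lo, simpleT_hi, lt, lt', lt.not_gt, lt'.not_gt, if_true, if_false]
    · have h3 : w⁻¹ (hiIdx k) = loIdx i := by rw [← h1]; simp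
      have h4 : w⁻¹ (loIdx k) = hiIdx i := by rw [← h2]; simp
      simp only [← mul_assoc, e, e2, h1, h2, h3, h4, simpleT_lo, simpleT_hi, lt, lt', lt.not_gt, lt'.not_gt, if_true, if_false]
  · have hA : simpleT i (w⁻¹ (loIdx k)) < simpleT i (w⁻¹ (hiIdx k)) ↔
        w⁻¹ (loIdx k) < w⁻¹ (hiIdx k) := by
      apply lt_iff_simpleT
      · rintro ⟨h1, h2⟩; apply h; left; rw [← h1, ← h2]; simp
      · rintro ⟨h1, h2⟩; apply h; right; rw [← h1, ← h2]; simp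
    have hB : simpleT k (w (loIdx i)) < simpleT k (w (hiIdx i)) ↔
        w (loIdx i) < w (hiIdx i) := by
      apply lt_iff_simpleT
      · exact fun h' => h (Or.inl h')
      · exact fun h' => h (Or.inr ⟨h'.2, h'.1⟩)
    simp only [hA, hB, mul_assoc]
    split_ifs <;> module

lemma lop_tOp (q : R) (k i : Fin (r - 1)) (f : VV R r) :
    lop q k (tOp q i f) = tOp q i (lop q k f) := by
  funext w
  have h := congrFun (lop_ro q k i f) w
  rw [tOp_apply, ← h]
  simp only [lop, tOp_apply]
  split_ifs
  · simp only [map_smul]; module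
  · simp only [map_add, map_smul]; module

lemma lop_act (q : R) (k : Fin (r - 1)) (h : HA R q r) (f : VV R r) :
    lop q k (act q h f) = act q h (lop q k f) := by
  induction h using hc_induction generalizing f with
  | hone => simp only [act_one]
  | hadd x y hx hy => rw [act_add, act_add, lop_add, hx, hy]
  | hsmul a x hx => rw [act_smul, act_smul, lop_smul, hx]
  | hT x i hx => rw [act_mul, act_mul, act_T, act_T, lop_tOp, hx]
  | hC x i hx => rw [act_mul, act_mul, act_C, act_C, lop_cOp, hx]

/-- The vacuum vector. -/
def e1 (R : Type) [CommRing R] (r : ℕ) : VV R r := fun w => if w = 1 then 1 else 0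

lemma tOp_e1 (q : R) (k : Fin (r - 1)) : tOp q k (e1 R r) = lop q k (e1 R r) := by
  funext w
  have lt := lo_lt_hi k
  simp only [tOp_apply, ro, lop, LinearMap.coe_mk, AddHom.coe_mk, e1]
  rw [show Equiv.swap (loIdx k) (hiIdx k) = simpleT k from rfl]
  have e1 : w * simpleT k = 1 ↔ w = simpleT k := by
    rw [mul_eq_one_iff_eq_inv, simpleT_inv]
  have e2 : simpleT k * w = 1 ↔ w = simpleT k := by
    rw [mul_eq_one_iff_inv_eq, simpleT_inv, eq_comm]
  simp only [e1, e2]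
  by_cases h1 : w = 1
  · subst h1
    simp [(simpleT_ne_one k).symm, lt, dl_one]
  by_cases h2 : w = simpleT k
  · subst h2
    simp [simpleT_ne_one k, simpleT_inv, simpleT_lo, simpleT_hi, lt.not_gt, sg_one]
  · simp [h1, h2]

/-- The coordinates of an element. -/
def coor (q : R) (h : HA R q r) : VV R r := act q h (e1 R r)

lemma coor_T_mul (q : R) (k : Fin (r - 1)) (h : HA R q r) :
    coor q (tA R q r k * h) = lop q k (coor q h) := by
  rw [coor, coor, act_mul, act_T, tOp_e1, lop_act]

end Left

end

end HCPaper
namespace HCPaper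

noncomputable section

section TWsec

variable {R : Type} [CommRing R] {q : R} {r : ℕ}

/-- The `T_w` relations inside `HA`. -/
structure IsTWA (TW : Equiv.Perm (Fin r) → HA R q r) : Prop where
  one : TW 1 = 1
  up : ∀ (w : Equiv.Perm (Fin r)) (k : Fin (r - 1)), w (loIdx k) < w (hiIdx k) →
    TW (w * simpleT k) = TW w * tA R q r k

variable {TW : Equiv.Perm (Fin r) → HA R q r}

lemma mul_s_s (w : Equiv.Perm (Fin r)) (k : Fin (r - 1)) : w * simpleT k * simpleT k = w := by
  rw [mul_assoc, simpleT_mul_self, mul_one]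

lemma s_mul_s (w : Equiv.Perm (Fin r)) (k : Fin (r - 1)) : simpleT k * (simpleT k * w) = w := by
  rw [← mul_assoc, simpleT_mul_self, one_mul]

lemma IsTWA.down (H : IsTWA TW) (w : Equiv.Perm (Fin r)) (k : Fin (r - 1))
    (h : w (hiIdx k) < w (loIdx k)) :
    TW w * tA R q r k = (q - 1) • TW w + q • TW (w * simpleT k) := by
  have h' : (w * simpleT k) (loIdx k) < (w * simpleT k) (hiIdx k) := by
    simpa only [Equiv.Perm.mul_apply, simpleT_lo, simpleT_hi] using h
  have e := H.up _ k h'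
  rw [mul_s_s] at e
  rw [e, mul_assoc, TT_sq, mul_add, mul_smul_comm, mul_smul_comm, mul_one]

lemma IsTWA.left_up (H : IsTWA TW) (w : Equiv.Perm (Fin r)) (k : Fin (r - 1))
    (h : w⁻¹ (loIdx k) < w⁻¹ (hiIdx k)) : TW (simpleT k * w) = tA R q r k * TW w := by
  induction hn : len w using Nat.strong_induction_on generalizing w with
  | _ n ih =>
    by_cases h1 : w = 1
    · subst h1
      have := H.up 1 k (by simpa using lo_lt_hi k)
      rw [H.one, one_mul, one_mul] at this
      rw [mul_one, this, H.one, mul_one]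
    obtain ⟨j, hj⟩ := exists_descent w h1
    have l1 := len_mul_down w j hj
    have l2 := len_mul_left_up w k h
    set v := w * simpleT j with hv
    have ew : w = v * simpleT j := by rw [hv, mul_s_s]
    have hvj : v (loIdx j) < v (hiIdx j) := by
      simpa only [hv, Equiv.Perm.mul_apply, simpleT_lo, simpleT_hi] using hj
    clear_value v
    have h3 : (simpleT k * v) (loIdx j) < (simpleT k * v) (hiIdx j) ∨
      (simpleT k * v) (hiIdx j) < (simpleT k * v) (loIdx j) :=
        lt_or_gt_of_ne ((simpleT k * v).injective.ne (lo_ne_hi j))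
    have h4 : v⁻¹ (loIdx k) < v⁻¹ (hiIdx k) ∨ v⁻¹ (hiIdx k) < v⁻¹ (loIdx k) :=
        lt_or_gt_of_ne (v⁻¹.injective.ne (lo_ne_hi k))
    have es : simpleT k * w = simpleT k * v * simpleT j := by rw [mul_assoc, ← ew]
    have l3 : len (simpleT k * w) ≤ len (simpleT k * v) + 1 := by
      rw [es]
      rcases h3 with h3 | h3
      · exact (len_mul_up _ j h3).le
      · have := len_mul_down _ j h3; omega
    rcases h4 with h4 | h4
    · have l4 := len_mul_left_up v k h4
      have i1 := ih (len v) (by omega) v h4 rfl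
      have h5 := (len_mul_iff (simpleT k * v) j).1 (by rw [← es]; omega)
      rw [es, H.up _ j h5, i1, ew, H.up _ j hvj, mul_assoc]
    · have l4 := len_mul_left_down v k h4
      omega

lemma IsTWA.left_down (H : IsTWA TW) (w : Equiv.Perm (Fin r)) (k : Fin (r - 1))
    (h : w⁻¹ (hiIdx k) < w⁻¹ (loIdx k)) :
    tA R q r k * TW w = (q - 1) • TW w + q • TW (simpleT k * w) := by
  have h' : (simpleT k * w)⁻¹ (loIdx k) < (simpleT k * w)⁻¹ (hiIdx k) := by
    simpa only [mul_inv_rev, simpleT_inv, Equiv.Perm.mul_apply, simpleT_lo, simpleT_hi] using h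
  have e := H.left_up _ k h'
  rw [s_mul_s] at e
  rw [e, ← mul_assoc, TT_sq, add_mul, smul_mul_assoc, smul_mul_assoc, one_mul]

/-- Reconstruct an element from coordinates. -/
def recon (TW : Equiv.Perm (Fin r) → HA R q r) (f : VV R r) : HA R q r :=
  ∑ w, TW w * clPi R q r (f w)

lemma recon_cOp (j : Fin r) (f : VV R r) : recon TW (cOp R j f) = recon TW f * cA R q r j := by
  simp only [recon, cOp_apply, map_mul, clPi_cg, Finset.sum_mul, mul_assoc]

lemma sum_simpleT {M : Type} [AddCommMonoid M] (k : Fin (r - 1)) (F : Equiv.Perm (Fin r) → M) :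
    ∑ w, F (w * simpleT k) = ∑ w, F w :=
  Equiv.sum_comp (Equiv.mulRight (simpleT k)) F

lemma IsTWA.recon_ro (H : IsTWA TW) (k : Fin (r - 1)) (f : VV R r) :
    ∑ w, TW w * clPi R q r (ro q (loIdx k) (hiIdx k) f w)
      = ∑ w, TW w * tA R q r k * clPi R q r (f w) := by
  classical
  let A : Equiv.Perm (Fin r) → HA R q r := fun w =>
    if w (loIdx k) < w (hiIdx k) then q • (TW w * clPi R q r (f (w * simpleT k)))
    else TW w * clPi R q r (f (w * simpleT k))
  let B : Equiv.Perm (Fin r) → HA R q r := fun w =>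
    if w (loIdx k) < w (hiIdx k) then 0 else (q - 1) • (TW w * clPi R q r (f w))
  have e1 : ∀ w, TW w * clPi R q r (ro q (loIdx k) (hiIdx k) f w) = A w + B w := by
    intro w
    simp only [ro, LinearMap.coe_mk, AddHom.coe_mk, A, B]
    rw [show Equiv.swap (loIdx k) (hiIdx k) = simpleT k from rfl]
    split_ifs <;> simp [mul_add]
  have e2 : ∀ w, TW w * tA R q r k * clPi R q r (f w) = A (w * simpleT k) + B w := by
    intro w
    simp only [A, B, Equiv.Perm.mul_apply, simpleT_lo, simpleT_hi, mul_s_s]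
    rcases lt_or_gt_of_ne (w.injective.ne (lo_ne_hi k)) with h | h
    · rw [if_pos h, if_neg h.not_gt, H.up w k h, add_zero]
    · rw [if_pos h, if_neg h.not_gt, H.down w k h, add_mul, smul_mul_assoc, smul_mul_assoc,
        add_comm]
  simp only [e1, e2, Finset.sum_add_distrib, sum_simpleT k A]

lemma IsTWA.recon_tOp (H : IsTWA TW) (k : Fin (r - 1)) (f : VV R r) :
    recon TW (tOp q k f) = recon TW f * tA R q r k := by
  have e : ∀ w, sg q k (ro q (loIdx k) (hiIdx k) f w)
      = ro q (loIdx k) (hiIdx k) (fun v => sg q k (f v)) w := by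
    intro w
    simp only [ro, LinearMap.coe_mk, AddHom.coe_mk]
    split_ifs <;> simp
  simp only [recon, tOp_apply, map_add, mul_add, Finset.sum_add_distrib, e]
  rw [H.recon_ro, ← Finset.sum_add_distrib, Finset.sum_mul]
  refine Finset.sum_congr rfl fun w _ => ?_
  rw [mul_assoc, mul_assoc, clPi_T, mul_add]

lemma recon_add (f g : VV R r) : recon TW (f + g) = recon TW f + recon TW g := by
  simp only [recon, Pi.add_apply, map_add, mul_add, Finset.sum_add_distrib]

lemma recon_smul (a : R) (f : VV R r) : recon TW (a • f) = a • recon TW f := by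
  simp only [recon, Pi.smul_apply, map_smul, mul_smul_comm, Finset.smul_sum]

lemma IsTWA.recon_act (H : IsTWA TW) (h : HA R q r) (f : VV R r) :
    recon TW (act q h f) = recon TW f * h := by
  induction h using hc_induction generalizing f with
  | hone => rw [act_one, mul_one]
  | hadd x y hx hy => rw [act_add, recon_add, hx, hy, mul_add]
  | hsmul a x hx => rw [act_smul, recon_smul, hx, mul_smul_comm]
  | hT x i hx => rw [act_mul, act_T, H.recon_tOp, hx, mul_assoc]
  | hC x i hx => rw [act_mul, act_C, recon_cOp, hx, mul_assoc]

lemma IsTWA.recon_coor (H : IsTWA TW) (h : HA R q r) : recon TW (coor q h) = h := by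
  rw [coor, H.recon_act]
  have : recon TW (e1 R r) = 1 := by
    rw [recon, Finset.sum_eq_single 1]
    · simp [e1, H.one]
    · intro b _ hb; simp [e1, hb]
    · simp
  rw [this, one_mul]

end TWsec

end

end HCPaper
namespace HCPaper

noncomputable section

section Young

variable {r n : ℕ}

lemma psum_mono (lam : Fin n → ℕ) {a c : ℕ} (h : a ≤ c) : psum lam a ≤ psum lam c := by
  unfold psum
  refine Finset.sum_le_sum fun i _ => ?_
  split_ifs <;> omega

lemma psum_succ (lam : Fin n → ℕ) (k : Fin n) : psum lam (k + 1) = psum lam k + lam k := by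
  unfold psum
  have : lam k = ∑ i : Fin n, if i = k then lam i else 0 := by simp
  rw [this, ← Finset.sum_add_distrib]
  refine Finset.sum_congr rfl fun i _ => ?_
  have : i = k ↔ (i : ℕ) = k := Fin.ext_iff
  simp only [this]
  split_ifs <;> omega

lemma block_exists (lam : Fin n → ℕ) (hlam : ∑ i, lam i = r) (j : Fin r) :
    ∃ k, InBlock lam k j := by
  have hn : psum lam n = r := by
    rw [← hlam, psum]
    exact Finset.sum_congr rfl fun i _ => by simp
  have hex : ∃ m, (j : ℕ) < psum lam m := ⟨n, by rw [hn]; exact j.2⟩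
  classical
  have h1 := Nat.find_spec hex
  have h2 : Nat.find hex ≤ n := Nat.find_min' hex (by rw [hn]; exact j.2)
  have h3 : Nat.find hex ≠ 0 := by
    intro h
    rw [h] at h1
    simp [psum] at h1
  obtain ⟨m, hm⟩ := Nat.exists_eq_succ_of_ne_zero h3
  have h4 := Nat.find_min hex (m := m) (by omega)
  rw [hm] at h1
  refine ⟨⟨m, by omega⟩, by simpa using h4, ?_⟩
  rw [← psum_succ]
  exact h1

lemma block_le (lam : Fin n → ℕ) {k k' : Fin n} {a c : Fin r} (h : a ≤ c)
    (h1 : InBlock lam k a) (h2 : InBlock lam k' c) : k ≤ k' := by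
  by_contra hc
  have h3 : (k' : ℕ) + 1 ≤ k := by simpa using hc
  have h4 := psum_mono lam h3
  rw [psum_succ] at h4
  have h5 := h1.1
  have h6 := h2.2
  have h7 : (a : ℕ) ≤ c := h
  omega

/-- Block function description of the Young subgroup. -/
lemma exists_block (lam : Fin n → ℕ) (hlam : ∑ i, lam i = r) :
    ∃ b : Fin r → Fin n, Monotone b ∧
      ∀ w : Equiv.Perm (Fin r), MemYoung lam w ↔ ∀ j, b (w j) = b j := by
  choose b hb using block_exists lam hlam
  have hu : ∀ j k, InBlock lam k j → b j = k := fun j k h =>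
    le_antisymm (block_le lam le_rfl (hb j) h) (block_le lam le_rfl h (hb j))
  refine ⟨b, fun a c h => block_le lam h (hb a) (hb c), fun w => ⟨fun h j => ?_, fun h k j hj => ?_⟩⟩
  · exact hu _ _ (h _ _ (hb j))
  · rw [← hu _ _ hj, ← h j]; exact hb _

/-- The Young subgroup of a block function. -/
def YY (b : Fin r → Fin n) (w : Equiv.Perm (Fin r)) : Prop := ∀ j, b (w j) = b j

variable {b : Fin r → Fin n}

lemma YY_one : YY b 1 := fun _ => rfl

lemma YY.mul {u v : Equiv.Perm (Fin r)} (hu : YY b u) (hv : YY b v) : YY b (u * v) := fun j => by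
  rw [Equiv.Perm.mul_apply, hu, hv]

lemma YY.inv {u : Equiv.Perm (Fin r)} (hu : YY b u) : YY b u⁻¹ := fun j => by
  rw [← hu]; simp

lemma YY_simple (k : Fin (r - 1)) (h : b (loIdx k) = b (hiIdx k)) : YY b (simpleT k) := by
  intro j
  by_cases h1 : j = loIdx k
  · rw [h1, simpleT_lo, h]
  by_cases h2 : j = hiIdx k
  · rw [h2, simpleT_hi, h]
  rw [simpleT_other k h1 h2]

lemma YY.simple {k : Fin (r - 1)} (h : YY b (simpleT k)) : b (loIdx k) = b (hiIdx k) := by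
  have := h (loIdx k)
  rw [simpleT_lo] at this
  exact this.symm

lemma YY.descent (hb : Monotone b) {u : Equiv.Perm (Fin r)} (hu : YY b u) (h1 : u ≠ 1) :
    ∃ k, YY b (simpleT k) ∧ u⁻¹ (hiIdx k) < u⁻¹ (loIdx k) := by
  obtain ⟨k, hk⟩ := exists_descent u⁻¹ (by simpa using h1)
  refine ⟨k, YY_simple k (le_antisymm (hb (lo_lt_hi k).le) ?_), hk⟩
  have := hb hk.le
  rwa [hu.inv, hu.inv] at this

/-- Distinguished coset representatives. -/
def DD (b : Fin r → Fin n) (d : Equiv.Perm (Fin r)) : Prop :=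
  ∀ k, YY b (simpleT k) → d⁻¹ (loIdx k) < d⁻¹ (hiIdx k)

lemma DD.lt (hb : Monotone b) {d : Equiv.Perm (Fin r)} (hd : DD b d) (m : ℕ) :
    ∀ a c : Fin r, (c : ℕ) = a + m + 1 → b a = b c → d⁻¹ a < d⁻¹ c := by
  induction m with
  | zero =>
    intro a c h e
    obtain ⟨k, hk⟩ : ∃ k : Fin (r - 1), (k : ℕ) = a := ⟨⟨a, by omega⟩, rfl⟩
    have ea : a = loIdx k := Fin.ext hk.symm
    have ec : c = hiIdx k := Fin.ext (by simp only [hiIdx]; omega)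
    rw [ea, ec] at e ⊢
    exact hd _ (YY_simple _ e)
  | succ m ih =>
    intro a c h e
    have hm : (a : ℕ) + 1 < r := by omega
    set x : Fin r := ⟨a + 1, hm⟩ with hx
    have h1 : b a ≤ b x := hb (by simp [hx, Fin.le_def])
    have h2 : b x ≤ b c := hb (by simp only [hx, Fin.le_def]; omega)
    have e1 : b a = b x := le_antisymm h1 (e ▸ h2)
    have ea : a = loIdx (⟨a, by omega⟩ : Fin (r - 1)) := rfl
    have ex : x = hiIdx (⟨a, by omega⟩ : Fin (r - 1)) := rfl
    have e3 := e1
    rw [ea, ex] at e3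
    have h3 := hd _ (YY_simple _ e3)
    rw [← ea, ← ex] at h3
    exact h3.trans (ih x c (by simp only [hx]; omega) (e1.symm.trans e))

lemma DD.lt' (hb : Monotone b) {d : Equiv.Perm (Fin r)} (hd : DD b d) {a c : Fin r}
    (h : a < c) (e : b a = b c) : d⁻¹ a < d⁻¹ c :=
  hd.lt hb (c - a - 1) a c (by have : (a : ℕ) < c := h; omega) e

lemma key_lt (hb : Monotone b) {u d : Equiv.Perm (Fin r)} (hu : YY b u) (hd : DD b d)
    {k : Fin (r - 1)} (hk : YY b (simpleT k)) (h : u⁻¹ (loIdx k) < u⁻¹ (hiIdx k)) :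
    (u * d)⁻¹ (loIdx k) < (u * d)⁻¹ (hiIdx k) := by
  rw [mul_inv_rev, Equiv.Perm.mul_apply, Equiv.Perm.mul_apply]
  exact hd.lt' hb h (by rw [hu.inv, hu.inv, hk.simple])

lemma key_gt (hb : Monotone b) {u d : Equiv.Perm (Fin r)} (hu : YY b u) (hd : DD b d)
    {k : Fin (r - 1)} (hk : YY b (simpleT k)) (h : u⁻¹ (hiIdx k) < u⁻¹ (loIdx k)) :
    (u * d)⁻¹ (hiIdx k) < (u * d)⁻¹ (loIdx k) := by
  rw [mul_inv_rev, Equiv.Perm.mul_apply, Equiv.Perm.mul_apply]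
  exact hd.lt' hb h (by rw [hu.inv, hu.inv, hk.simple])

lemma decomp_exists (w : Equiv.Perm (Fin r)) : ∃ u d, YY b u ∧ DD b d ∧ u * d = w := by
  induction hn : len w using Nat.strong_induction_on generalizing w with
  | _ m ih =>
    by_cases hw : DD b w
    · exact ⟨1, w, YY_one, hw, one_mul w⟩
    unfold DD at hw
    push Not at hw
    obtain ⟨k, hk, hlt⟩ := hw
    have hlt' := lt_of_le_of_ne hlt (w⁻¹.injective.ne (lo_ne_hi k).symm)
    have l := len_mul_left_down w k hlt'
    obtain ⟨u, d, hu, hd, e⟩ := ih (len (simpleT k * w)) (by omega) _ rfl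
    exact ⟨simpleT k * u, d, hk.mul hu, hd, by rw [mul_assoc, e, s_mul_s]⟩

lemma decomp_unique (hb : Monotone b) {u d u' d' : Equiv.Perm (Fin r)} (hu : YY b u) (hd : DD b d)
    (hu' : YY b u') (hd' : DD b d') (e : u * d = u' * d') : u = u' ∧ d = d' := by
  have hv : YY b (u'⁻¹ * u) := hu'.inv.mul hu
  have e1 : u'⁻¹ * u * d = d' := by rw [mul_assoc, e]; simp
  have h1 : u'⁻¹ * u = 1 := by
    by_contra hne
    obtain ⟨k, hk, hlt⟩ := hv.descent hb hne
    have h2 := key_gt hb hv hd hk hlt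
    rw [e1] at h2
    exact absurd (hd' k hk) h2.asymm
  refine ⟨(inv_mul_eq_one.1 h1).symm, ?_⟩
  rw [← e1, h1, one_mul]

open Classical in
lemma sum_decomp (hb : Monotone b) {M : Type} [AddCommMonoid M] (F : Equiv.Perm (Fin r) → M) :
    ∑ w, F w = ∑ u with YY b u, ∑ d with DD b d, F (u * d) := by
  rw [← Finset.sum_product']
  symm
  refine Finset.sum_bij (fun p _ => p.1 * p.2) (fun _ _ => Finset.mem_univ _) ?_ ?_ ?_
  · rintro ⟨u, d⟩ h ⟨u', d'⟩ h' e
    simp only [Finset.mem_product, Finset.mem_filter, Finset.mem_univ, true_and] at h h'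
    obtain ⟨h1, h2⟩ := decomp_unique hb h.1 h.2 h'.1 h'.2 e
    rw [h1, h2]
  · intro w _
    obtain ⟨u, d, hu, hd, e⟩ := decomp_exists (b := b) w
    exact ⟨(u, d), by simp [hu, hd], e⟩
  · intros; rfl

variable {R : Type} [CommRing R] {q : R} {TW : Equiv.Perm (Fin r) → HA R q r}

/-- Induction over the Young subgroup. -/
lemma YY.induction (hb : Monotone b) {P : Equiv.Perm (Fin r) → Prop} (h1 : P 1)
    (hs : ∀ v k, YY b v → YY b (simpleT k) → v⁻¹ (loIdx k) < v⁻¹ (hiIdx k) → P v →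
      P (simpleT k * v)) (u : Equiv.Perm (Fin r)) (hu : YY b u) : P u := by
  induction hn : len u using Nat.strong_induction_on generalizing u with
  | _ m ih =>
    by_cases hne : u = 1
    · rw [hne]; exact h1
    obtain ⟨k, hk, hlt⟩ := hu.descent hb hne
    have l := len_mul_left_down u k hlt
    have hv := hk.mul hu
    have := hs (simpleT k * u) k hv hk (by
      simpa only [mul_inv_rev, simpleT_inv, Equiv.Perm.mul_apply, simpleT_lo, simpleT_hi] using hlt)
      (ih _ (by omega) _ hv rfl)
    rwa [s_mul_s] at this

lemma IsTWA.mul_YD (H : IsTWA TW) (hb : Monotone b) {d : Equiv.Perm (Fin r)} (hd : DD b d)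
    (u : Equiv.Perm (Fin r)) (hu : YY b u) : TW (u * d) = TW u * TW d := by
  refine YY.induction hb (P := fun u => TW (u * d) = TW u * TW d) ?_ ?_ u hu
  · rw [one_mul, H.one, one_mul]
  · intro v k hv hk hlt ih
    rw [mul_assoc, H.left_up _ k (key_lt hb hv hd hk hlt), ih, H.left_up v k hlt, mul_assoc]

lemma coor_YD (hb : Monotone b) {c : R} (hc : c * q = -1) (f : VV R r)
    (hf : ∀ k, YY b (simpleT k) → lop q k f = -f) {d : Equiv.Perm (Fin r)} (hd : DD b d)
    (u : Equiv.Perm (Fin r)) (hu : YY b u) : f (u * d) = c ^ len u • f d := by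
  refine YY.induction hb (P := fun u => f (u * d) = c ^ len u • f d) ?_ ?_ u hu
  · rw [one_mul, len_one, pow_zero, one_smul]
  · intro v k hv hk hlt ih
    have h1 := congrFun (hf k hk) (v * d)
    rw [lop, if_pos (key_lt hb hv hd hk hlt), Pi.neg_apply] at h1
    have h2 := congrArg (fun x => c • x) h1
    simp only [smul_smul, hc, neg_smul, one_smul, smul_neg, neg_inj] at h2
    rw [mul_assoc, h2, ih, len_mul_left_up v k hlt, smul_smul, pow_succ, mul_comm]

open Classical in
/-- The element `y`. -/
def yA (b : Fin r → Fin n) (c : R) (TW : Equiv.Perm (Fin r) → HA R q r) : HA R q r :=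
  ∑ u with YY b u, c ^ len u • TW u

lemma IsTWA.exists_of_anti (H : IsTWA TW) (hb : Monotone b) {c : R} (hc : c * q = -1)
    (h : HA R q r) (hh : ∀ k, YY b (simpleT k) → tA R q r k * h = -h) :
    ∃ g, yA b c TW * g = h := by
  classical
  have hf : ∀ k, YY b (simpleT k) → lop q k (coor q h) = -(coor q h) := by
    intro k hk
    rw [← coor_T_mul, hh k hk]
    have : (-h : HA R q r) = (-1 : R) • h := by module
    rw [this, coor, act_smul, coor]
    module
  refine ⟨∑ d with DD b d, TW d * clPi R q r (coor q h d), ?_⟩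
  conv_rhs => rw [← H.recon_coor h, recon, sum_decomp hb]
  rw [yA, Finset.sum_mul]
  refine Finset.sum_congr rfl fun u hu => ?_
  rw [Finset.mul_sum]
  refine Finset.sum_congr rfl fun d hd => ?_
  simp only [Finset.mem_filter, Finset.mem_univ, true_and] at hu hd
  rw [H.mul_YD hb hd u hu, coor_YD hb hc _ hf hd u hu, map_smul, mul_smul_comm, smul_mul_assoc,
    mul_assoc]

lemma IsTWA.anti (H : IsTWA TW) {c : R} (hc : c * q = -1) (k : Fin (r - 1))
    (hk : YY b (simpleT k)) : tA R q r k * yA b c TW = -yA b c TW := by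
  classical
  rw [eq_neg_iff_add_eq_zero, yA, Finset.mul_sum, ← Finset.sum_add_distrib]
  have key : ∀ w : Equiv.Perm (Fin r), w⁻¹ (loIdx k) < w⁻¹ (hiIdx k) →
      (tA R q r k * c ^ len w • TW w + c ^ len w • TW w) +
      (tA R q r k * c ^ len (simpleT k * w) • TW (simpleT k * w)
        + c ^ len (simpleT k * w) • TW (simpleT k * w)) = 0 := by
    intro w h
    have h' : (simpleT k * w)⁻¹ (hiIdx k) < (simpleT k * w)⁻¹ (loIdx k) := by
      simpa only [mul_inv_rev, simpleT_inv, Equiv.Perm.mul_apply, simpleT_lo, simpleT_hi] using h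
    rw [mul_smul_comm, mul_smul_comm, H.left_down _ k h', s_mul_s, ← H.left_up w k h,
      len_mul_left_up w k h]
    have e : c ^ (len w + 1) * q = - c ^ len w := by rw [pow_succ, mul_assoc, hc]; ring
    have : c ^ (len w + 1) • ((q - 1) • TW (simpleT k * w) + q • TW w)
        + c ^ (len w + 1) • TW (simpleT k * w)
        = (c ^ (len w + 1) * q) • (TW (simpleT k * w) + TW w) := by module
    rw [this, e]
    module
  refine Finset.sum_involution (fun w _ => simpleT k * w) ?_ ?_ ?_ ?_
  · intro w _
    rcases lt_or_gt_of_ne (w⁻¹.injective.ne (lo_ne_hi k)) with h | h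
    · exact key w h
    · have h' : (simpleT k * w)⁻¹ (loIdx k) < (simpleT k * w)⁻¹ (hiIdx k) := by
        simpa only [mul_inv_rev, simpleT_inv, Equiv.Perm.mul_apply, simpleT_lo, simpleT_hi] using h
      have := key _ h'
      rw [s_mul_s, add_comm] at this
      exact this
  · intro w _ _ e
    exact simpleT_ne_one k (by simpa using e)
  · intro w hw
    simp only [Finset.mem_filter, Finset.mem_univ, true_and] at hw ⊢
    exact hk.mul hw
  · intro w _
    exact s_mul_s w k

lemma IsTWA.final (H : IsTWA TW) (lam : Fin n → ℕ) (hlam : ∑ i, lam i = r) {c : R}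
    (hc : c * q = -1) (h : HA R q r) :
    (∃ g : HA R q r, (∑ w, if MemYoung lam w then c ^ (len w) • TW w else 0) * g = h) ↔
      ∀ k : Fin (r - 1), MemYoung lam (simpleT k) → tA R q r k * h = -h := by
  classical
  obtain ⟨b, hb, hY⟩ := exists_block lam hlam
  have hy : (∑ w, if MemYoung lam w then c ^ (len w) • TW w else 0) = yA b c TW := by
    rw [yA, Finset.sum_filter]
    refine Finset.sum_congr rfl fun w _ => ?_
    have e : YY b w ↔ MemYoung lam w := (hY w).symm
    simp only [e]
  rw [hy]
  constructor
  · rintro ⟨g, rfl⟩ k hk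
    rw [← mul_assoc, H.anti hc k ((hY _).1 hk), neg_mul]
  · intro hh
    exact H.exists_of_anti hb hc h (fun k hk => hh k ((hY _).2 hk))

end Young

end

end HCPaper

open HCPaper in
/-- `y_λ H^c_{r,R} = {h : T_{s_k} h = -h for all s_k ∈ S_λ}`, for invertible `q`. -/
theorem stmt14 (R : Type) [CommRing R] (h2 : ringChar R ≠ 2) (q : R) (hq : IsUnit q)
    (r n : ℕ) (lam : Fin n → ℕ) (hlam : ∑ i, lam i = r)
    (TW : Equiv.Perm (Fin r) → HC R q r) (hTW : IsTW q r TW) :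
    Set.range (fun h : HC R q r => yElt lam TW * h)
      = {h : HC R q r | ∀ k : Fin (r - 1), MemYoung lam (simpleT k) →
          TT R q r k * h = -h} := by
  have H : IsTWA (R := R) (q := q) (r := r) TW :=
    ⟨hTW.1, fun w k h => hTW.2 w k (len_mul_up w k h)⟩
  have hc : (-(Ring.inverse q)) * q = -1 := by
    rw [neg_mul, Ring.inverse_mul_cancel q hq]
  ext h
  exact H.final lam hlam hc h
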